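/- (Lemma 1, full-sum form.) Let σ² > 0, ϑ₀, ϑ₁ ∈ ℝ, ϑ₂ > 0 with ϑ₁²/(4ϑ₂²) − ϑ₀/ϑ₂ + π² > 0. Set Γ = ϑ₁²/(4ϑ₂²) − ϑ₀/ϑ₂, Γ₀ = √|Γ| and λ_ℓ = π² ϑ₂ ℓ² + ϑ₁²/(4ϑ₂) − ϑ₀. Define the symmetric function ρ on [0,1]² by, for x ≤ y: ρ(x,y) = (σ²/(2ϑ₂)) · sin(Γ₀(1−y)) sin(Γ₀ x)/(Γ₀ sin Γ₀) if Γ < 0; ρ(x,y) = (σ²/(2ϑ₂)) · x(1−y) if Γ = 0; and ρ(x,y) = (σ²/(2ϑ₂)) · sinh(Γ₀(1−y)) sinh(Γ₀ x)/(Γ₀ sinh Γ₀) if Γ > 0. Then for every integer M ≥ 2, every m with 1 ≤ m ≤ M − 1, and with y_k = k/M: ∑_{ℓ ∈ I_m^+ ∪ I_m^−} σ²/(2λ_ℓ) = (2/M²) · ∑_{k=0}^{M} ∑_{l=0}^{M} ρ(y_k, y_l) · sin(π m y_k) · sin(π m y_l), and the series on the left converges absolutely. Consequently, s_m² := ∑_{ℓ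 ∈ I_m^+ ∪ I_m^−, ℓ ≥ LM} σ²/(2λ_ℓ) = (1/M²) b_m^⊤ Σ b_m − ∑_{ℓ ∈ I_m^+ ∪ I_m^−, ℓ < LM} σ²/(2λ_ℓ) for any positive integer L, where Σ_{kl} = ρ(y_k, y_l) and b_m = √2 (sin(π m y_0), …, sin(π m y_M))^⊤. -/

import Mathlib

open Real Finset

theorem three_term_eigen_sum {g h v : ℕ → ℝ} {c d : ℝ} {M : ℕ}
    (hg : ∀ k, g (k + 2) + g k = 2 * c * g (k + 1))
    (hh : ∀ k, h (k + 2) + h k = 2 * c * h (k + 1))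
    (hv : ∀ k, v (k + 2) + v k = 2 * d * v (k + 1))
    (hg0 : g 0 = 0) (hv0 : v 0 = 0) (hhM : h M = 0) (hvM : v M = 0) {l : ℕ} (hl : l ≤ M) :
    (2 * c - 2 * d) * ∑ k ∈ range (M + 1), g (min k l) * h (max k l) * v k =
      h 0 * g 1 * v l := by
  have casoratian : ∀ l, h l * g (l + 1) - g l * h (l + 1) = h 0 * g 1 := by
    intro l
    induction l with
    | zero => simp [hg0]
    | succ l ih => linear_combination ih + h (l + 1) * hg l - g (l + 1) * hh l
  have lower : ∀ N, (2 * c - 2 * d) * ∑ k ∈ range (N + 1), g k * v k =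
      g (N + 1) * v N - g N * v (N + 1) := by
    intro N
    induction N with
    | zero => simp [hg0, hv0]
    | succ N ih =>
      rw [sum_range_succ, mul_add, ih]
      linear_combination g (N + 1) * hv N - v (N + 1) * hg N
  have upper : ∀ j, l + j ≤ M → (2 * c - 2 * d) * ∑ k ∈ Ico (l + 1) (l + j + 1), h k * v k =
      (h (l + j + 1) * v (l + j) - h (l + j) * v (l + j + 1)) -
        (h (l + 1) * v l - h l * v (l + 1)) := by
    intro j
    induction j with
    | zero => simp
    | succ j ih =>
      intro hj
      rw [← add_assoc, sum_Ico_succ_top (by lia), mul_add, ih (by lia)]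
      linear_combination h (l + j + 1) * hv (l + j) - v (l + j + 1) * hh (l + j)
  have hup := upper (M - l) (by lia)
  rw [Nat.add_sub_cancel' hl, hhM, hvM] at hup
  rw [range_eq_Ico, ← sum_Ico_consecutive _ (Nat.zero_le (l + 1)) (by lia : l + 1 ≤ M + 1)]
  have h₁ : ∑ k ∈ Ico 0 (l + 1), g (min k l) * h (max k l) * v k =
      h l * ∑ k ∈ range (l + 1), g k * v k := by
    rw [← range_eq_Ico, mul_sum]
    refine sum_congr rfl fun k hk => ?_
    have : k ≤ l := by simpa [Nat.lt_succ_iff] using hk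
    rw [min_eq_left this, max_eq_right this]
    ring
  have h₂ : ∑ k ∈ Ico (l + 1) (M + 1), g (min k l) * h (max k l) * v k =
      g l * ∑ k ∈ Ico (l + 1) (M + 1), h k * v k := by
    rw [mul_sum]
    refine sum_congr rfl fun k hk => ?_
    have : l ≤ k := by have := (mem_Ico.1 hk).1; lia
    rw [min_eq_right this, max_eq_left this]
    ring
  rw [h₁, h₂]
  linear_combination h l * lower l + g l * hup + v l * casoratian l

theorem sum_sin_sq_grid {M m : ℕ} (hm₁ : 1 ≤ m) (hm₂ : m < M) :
    ∑ k ∈ range (M + 1), Real.sin (π * m / M * k) ^ 2 = M / 2 := by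
  set θ : ℝ := π * m / M with hθ
  have hM : (0 : ℝ) < M := by exact_mod_cast (by lia : 0 < M)
  have hm : (0 : ℝ) < m := by exact_mod_cast hm₁
  have hmM : (m : ℝ) < M := by exact_mod_cast hm₂
  have hsin : Real.sin θ ≠ 0 := by
    refine (Real.sin_pos_of_pos_of_lt_pi (by positivity) ?_).ne'
    rw [hθ, div_lt_iff₀ hM]
    exact mul_lt_mul_of_pos_left hmM pi_pos
  have key : ∀ N : ℕ, 4 * Real.sin θ * ∑ k ∈ range (N + 1), Real.sin (θ * k) ^ 2 =
      (2 * N + 1) * Real.sin θ - Real.sin (2 * (θ * N) + θ) := by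
    intro N
    induction N with
    | zero => simp
    | succ N ih =>
      have e₁ : Real.sin (2 * (θ * N) + θ) = Real.sin (2 * (θ * (N + 1 : ℕ)) - θ) := by
        congr 1; push_cast; ring
      rw [sum_range_succ, mul_add, ih, e₁, Real.sin_sub, Real.sin_add, Real.cos_two_mul,
        Real.cos_sq']
      push_cast
      ring
  have hper : Real.sin (2 * (θ * M) + θ) = Real.sin θ := by
    rw [show 2 * (θ * M) + θ = θ + m * (2 * π) by rw [hθ]; field_simp; ring]
    exact Real.sin_add_nat_mul_two_pi θ m
  have := key M
  rw [hper] at this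
  apply mul_left_cancel₀ (mul_ne_zero four_ne_zero hsin)
  rw [this]
  ring

theorem summable_one_div_pi_sq_mul_sq_add {Γ : ℝ} (hΓ : 0 < Γ + π ^ 2) :
    Summable fun n : ℕ => 1 / (π ^ 2 * (n : ℝ) ^ 2 + Γ) := by
  have hε : 0 < min (π ^ 2) (Γ + π ^ 2) := lt_min (by positivity) hΓ
  rw [← summable_nat_add_iff 1]
  refine Summable.of_nonneg_of_le (fun n => ?_) (fun n => ?_)
    (((summable_nat_add_iff 1).2 (Real.summable_one_div_nat_pow.2 one_lt_two)).mul_left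
      (1 / min (π ^ 2) (Γ + π ^ 2)))
  all_goals
    have hle : min (π ^ 2) (Γ + π ^ 2) * ((n + 1 : ℕ) : ℝ) ^ 2 ≤
        π ^ 2 * ((n + 1 : ℕ) : ℝ) ^ 2 + Γ := by
      have h₁ : (0 : ℝ) ≤ ((n + 1 : ℕ) : ℝ) ^ 2 - 1 := by
        push_cast; nlinarith [(Nat.cast_nonneg n : (0 : ℝ) ≤ n)]
      nlinarith [mul_le_mul_of_nonneg_right (min_le_left (π ^ 2) (Γ + π ^ 2)) h₁,
        min_le_right (π ^ 2) (Γ + π ^ 2)]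
    have hpos : 0 < min (π ^ 2) (Γ + π ^ 2) * ((n + 1 : ℕ) : ℝ) ^ 2 := by positivity
  · exact one_div_nonneg.2 (hpos.le.trans hle)
  · rw [one_div_mul_one_div]
    exact one_div_le_one_div_of_le hpos hle

theorem tsum_inv_add_sub_inv_add {x x' : ℂ} (hx : x ∈ Complex.integerComplement)
    (hx' : x' ∈ Complex.integerComplement)
    (hs : Summable fun n : ℕ => 1 / (x + n) - 1 / (x' + n))
    (hs' : Summable fun n : ℕ => 1 / (x - (n + 1)) - 1 / (x' - (n + 1))) :
    ∑' n : ℕ, ((1 / (x + n) - 1 / (x' + n)) + (1 / (x - (n + 1)) - 1 / (x' - (n + 1)))) =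
      π * Complex.cot (π * x) - π * Complex.cot (π * x') := by
  have h := cot_series_rep' hx
  have h' := cot_series_rep' hx'
  have hsub := (summable_cotTerm hx).tsum_sub (summable_cotTerm hx')
  unfold cotTerm at hsub
  have hs1 := (summable_nat_add_iff 1).2 hs
  rw [hs.tsum_add hs', hs.tsum_eq_zero_add]
  have : ∑' n : ℕ, ((1 / (x - (n + 1)) + 1 / (x + (n + 1))) -
      (1 / (x' - (n + 1)) + 1 / (x' + (n + 1)))) =
      ∑' n : ℕ, (1 / (x + (n + 1 : ℕ)) - 1 / (x' + (n + 1 : ℕ))) +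
        ∑' n : ℕ, (1 / (x - (n + 1)) - 1 / (x' - (n + 1))) := by
    rw [← hs1.tsum_add hs']
    refine tsum_congr fun n => ?_
    push_cast
    ring
  rw [this] at hsub
  simp only [Nat.cast_zero, add_zero]
  linear_combination hsub - h + h'

theorem tsum_reflected_of_sq_eq_neg {M m : ℕ} (hm₁ : 1 ≤ m) (hm₂ : m < M) {Γ : ℝ}
    (hΓ : 0 < Γ + π ^ 2) {w : ℂ} (hw : w ^ 2 = -Γ) (hw0 : w ≠ 0) :
    ((∑' n : ℕ, (1 / (π ^ 2 * ((m + 2 * n * M : ℕ) : ℝ) ^ 2 + Γ) +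
        1 / (π ^ 2 * ((2 * M - m + 2 * n * M : ℕ) : ℝ) ^ 2 + Γ)) : ℝ) : ℂ) =
      Complex.sin (w / M) / (2 * M * w * (Complex.cos (w / M) - Complex.cos (π * m / M))) := by
  have hMpos : 0 < M := by lia
  have hM : (M : ℂ) ≠ 0 := by exact_mod_cast hMpos.ne'
  have hπ : (π : ℂ) ≠ 0 := by exact_mod_cast pi_ne_zero
  have hres : ∀ a : ℤ, a ≠ 0 → (π * a : ℂ) - w ≠ 0 ∧ (π * a : ℂ) + w ≠ 0 := by
    intro a ha
    have hprod : (π * a - w) * (π * a + w) ≠ (0 : ℂ) := by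
      have hR : π ^ 2 * (a : ℝ) ^ 2 + Γ ≠ 0 := by
        have h1 : (1 : ℝ) ≤ (a : ℝ) ^ 2 := by
          exact_mod_cast Int.one_le_abs (pow_ne_zero 2 ha) |>.trans_eq (abs_of_nonneg (sq_nonneg a))
        nlinarith [mul_le_mul_of_nonneg_left h1 (sq_nonneg π)]
      have hC : ((π ^ 2 * (a : ℝ) ^ 2 + Γ : ℝ) : ℂ) ≠ 0 := by exact_mod_cast hR
      push_cast at hC
      rw [show (π * a - w) * (π * a + w) = (π : ℂ) ^ 2 * a ^ 2 + Γ by linear_combination -hw]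
      exact hC
    exact ⟨left_ne_zero_of_mul hprod, right_ne_zero_of_mul hprod⟩
  have hshift : ∀ k : ℤ, (m : ℤ) + 2 * M * k ≠ 0 := by
    intro k hk
    rcases le_or_gt 0 k with h | h
    · have : 0 ≤ (M : ℤ) * k := by positivity
      lia
    · have : (M : ℤ) * k ≤ M * (-1) := mul_le_mul_of_nonneg_left (by lia) (by positivity)
      lia
  set x : ℂ := (π * m - w) / (2 * π * M) with hx
  set x' : ℂ := (π * m + w) / (2 * π * M) with hx'
  have hxadd : ∀ k : ℤ, x + k = (π * ((m + 2 * M * k : ℤ) : ℂ) - w) / (2 * π * M) := by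
    intro k; rw [hx]; push_cast; field_simp; ring
  have hxadd' : ∀ k : ℤ, x' + k = (π * ((m + 2 * M * k : ℤ) : ℂ) + w) / (2 * π * M) := by
    intro k; rw [hx']; push_cast; field_simp; ring
  have h2πM : (2 * π * M : ℂ) ≠ 0 := by simp [hπ, hM]
  have hxne : ∀ k : ℤ, x + k ≠ 0 := fun k => by
    rw [hxadd]; exact div_ne_zero (hres _ (hshift k)).1 h2πM
  have hxne' : ∀ k : ℤ, x' + k ≠ 0 := fun k => by
    rw [hxadd']; exact div_ne_zero (hres _ (hshift k)).2 h2πM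
  have hmem : x ∈ Complex.integerComplement := by
    rw [Complex.mem_integerComplement_iff]
    rintro ⟨k, hk⟩
    exact hxne (-k) (by rw [← hk]; push_cast; ring)
  have hmem' : x' ∈ Complex.integerComplement := by
    rw [Complex.mem_integerComplement_iff]
    rintro ⟨k, hk⟩
    exact hxne' (-k) (by rw [← hk]; push_cast; ring)
  have hterm : ∀ k : ℤ, 1 / (x + k) - 1 / (x' + k) =
      4 * π * M * w * (1 / ((π : ℂ) ^ 2 * ((m + 2 * M * k : ℤ) : ℂ) ^ 2 + Γ)) := by
    intro k
    obtain ⟨h₁, h₂⟩ := hres _ (hshift k)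
    rw [hxadd, hxadd', show (π : ℂ) ^ 2 * ((m + 2 * M * k : ℤ) : ℂ) ^ 2 + Γ =
      (π * ((m + 2 * M * k : ℤ) : ℂ) - w) * (π * ((m + 2 * M * k : ℤ) : ℂ) + w) by
        linear_combination hw]
    field_simp
    ring
  have hplus : ∀ n : ℕ, 1 / (x + n) - 1 / (x' + n) = 4 * π * M * w *
      ((1 / (π ^ 2 * ((m + 2 * n * M : ℕ) : ℝ) ^ 2 + Γ) : ℝ) : ℂ) := by
    intro n
    have := hterm n
    push_cast at this ⊢
    rw [this]
    congr 5
    ring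
  have hminus : ∀ n : ℕ, 1 / (x - (n + 1)) - 1 / (x' - (n + 1)) = 4 * π * M * w *
      ((1 / (π ^ 2 * ((2 * M - m + 2 * n * M : ℕ) : ℝ) ^ 2 + Γ) : ℝ) : ℂ) := by
    intro n
    have := hterm (-(n + 1))
    push_cast [Nat.cast_sub (by lia : m ≤ 2 * M)] at this ⊢
    rw [← sub_eq_add_neg, ← sub_eq_add_neg] at this
    rw [this]
    congr 3
    ring
  have hsum := summable_one_div_pi_sq_mul_sq_add hΓ
  have hinj : ∀ a : ℕ, Function.Injective fun n : ℕ => a + 2 * n * M := fun a n n' h => by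
    have := Nat.eq_of_mul_eq_mul_right hMpos (Nat.add_left_cancel h)
    lia
  have hs := hsum.comp_injective (hinj m)
  have hs' := hsum.comp_injective (hinj (2 * M - m))
  have hcot := tsum_inv_add_sub_inv_add hmem hmem'
    (by simp_rw [hplus]; exact (Complex.summable_ofReal.2 hs).mul_left _)
    (by simp_rw [hminus]; exact (Complex.summable_ofReal.2 hs').mul_left _)
  simp_rw [hplus, hminus, ← mul_add] at hcot
  rw [tsum_mul_left] at hcot
  simp_rw [← Complex.ofReal_add, ← Complex.ofReal_tsum] at hcot
  have hsx := sin_pi_mul_ne_zero hmem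
  have hsx' := sin_pi_mul_ne_zero hmem'
  have hsub : Complex.sin (w / M) = Complex.sin (π * x') * Complex.cos (π * x) -
      Complex.cos (π * x') * Complex.sin (π * x) := by
    rw [← Complex.sin_sub]
    congr 1
    rw [hx, hx']; field_simp; ring
  have hprod : Complex.cos (w / M) - Complex.cos (π * m / M) =
      2 * Complex.sin (π * x) * Complex.sin (π * x') := by
    rw [show w / M = π * x' - π * x by rw [hx, hx']; field_simp; ring,
      show π * m / M = π * x' + π * x by rw [hx, hx']; field_simp; ring,
      Complex.cos_sub, Complex.cos_add]
    ring
  rw [hsub, hprod, eq_div_iff (by simp [hM, hw0, hsx, hsx'])]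
  rw [Complex.cot, Complex.cot] at hcot
  field_simp at hcot
  linear_combination hcot

theorem tsum_reflected_of_neg {M m : ℕ} (hm₁ : 1 ≤ m) (hm₂ : m < M) {γ : ℝ}
    (hγ0 : 0 < γ) (hγ : γ < π) :
    ∑' n : ℕ, (1 / (π ^ 2 * ((m + 2 * n * M : ℕ) : ℝ) ^ 2 + -γ ^ 2) +
        1 / (π ^ 2 * ((2 * M - m + 2 * n * M : ℕ) : ℝ) ^ 2 + -γ ^ 2)) =
      Real.sin (γ / M) / (2 * M * γ * (Real.cos (γ / M) - Real.cos (π * m / M))) := by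
  have h := tsum_reflected_of_sq_eq_neg hm₁ hm₂ (Γ := -γ ^ 2) (w := γ) (by nlinarith)
    (by push_cast; ring) (by exact_mod_cast hγ0.ne')
  apply Complex.ofReal_injective
  rw [h]
  push_cast
  rfl

theorem tsum_reflected_of_pos {M m : ℕ} (hm₁ : 1 ≤ m) (hm₂ : m < M) {γ : ℝ}
    (hγ0 : 0 < γ) :
    ∑' n : ℕ, (1 / (π ^ 2 * ((m + 2 * n * M : ℕ) : ℝ) ^ 2 + γ ^ 2) +
        1 / (π ^ 2 * ((2 * M - m + 2 * n * M : ℕ) : ℝ) ^ 2 + γ ^ 2)) =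
      Real.sinh (γ / M) / (2 * M * γ * (Real.cosh (γ / M) - Real.cos (π * m / M))) := by
  have h := tsum_reflected_of_sq_eq_neg hm₁ hm₂ (Γ := γ ^ 2) (w := γ * Complex.I) (by positivity)
    (by push_cast; rw [mul_pow, Complex.I_sq]; ring) (by simp [hγ0.ne'])
  apply Complex.ofReal_injective
  rw [h, show (γ * Complex.I / M : ℂ) = γ / M * Complex.I by ring, Complex.sin_mul_I,
    Complex.cos_mul_I, show (2 * M * (γ * Complex.I) *
      (Complex.cosh (γ / M) - Complex.cos (π * m / M)) : ℂ) = 2 * M * γ *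
      (Complex.cosh (γ / M) - Complex.cos (π * m / M)) * Complex.I by ring,
    mul_div_mul_right _ _ Complex.I_ne_zero]
  push_cast
  rfl

theorem cos_pi_mul_div_lt_one {M m : ℕ} (hm₁ : 1 ≤ m) (hm₂ : m < M) :
    Real.cos (π * m / M) < 1 := by
  have hM : (0 : ℝ) < M := by exact_mod_cast (by lia : 0 < M)
  have hm : (0 : ℝ) < m := by exact_mod_cast hm₁
  have hmM : (m : ℝ) < M := by exact_mod_cast hm₂
  rw [← Real.cos_zero]
  refine Real.cos_lt_cos_of_nonneg_of_le_pi le_rfl ?_ (by positivity)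
  rw [div_le_iff₀ hM]
  exact mul_le_mul_of_nonneg_left hmM.le pi_pos.le

theorem tsum_reflected_of_zero {M m : ℕ} (hm₁ : 1 ≤ m) (hm₂ : m < M) :
    ∑' n : ℕ, (1 / (π ^ 2 * ((m + 2 * n * M : ℕ) : ℝ) ^ 2 + 0) +
        1 / (π ^ 2 * ((2 * M - m + 2 * n * M : ℕ) : ℝ) ^ 2 + 0)) =
      1 / M / (2 * M * (1 - Real.cos (π * m / M))) := by
  have hMpos : 0 < M := by lia
  have hM : (M : ℝ) ≠ 0 := by exact_mod_cast hMpos.ne'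
  have hcos := cos_pi_mul_div_lt_one hm₁ hm₂
  have hinj : ∀ a : ℕ, Function.Injective fun n : ℕ => a + 2 * n * M := fun a n n' h => by
    have := Nat.eq_of_mul_eq_mul_right hMpos (Nat.add_left_cancel h)
    lia
  have hsum := summable_one_div_pi_sq_mul_sq_add (Γ := 0) (by positivity)
  have hle : ∀ a : ℕ, 0 < a → ∀ γ : ℝ, 1 / (π ^ 2 * (a : ℝ) ^ 2 + γ ^ 2) ≤
      1 / (π ^ 2 * (a : ℝ) ^ 2 + 0) := fun a ha γ => by
    have : (0 : ℝ) < a := by exact_mod_cast ha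
    exact one_div_le_one_div_of_le (by positivity) (by nlinarith [sq_nonneg γ])
  have hcont : Continuous fun γ : ℝ =>
      ∑' n : ℕ, (1 / (π ^ 2 * ((m + 2 * n * M : ℕ) : ℝ) ^ 2 + γ ^ 2) +
        1 / (π ^ 2 * ((2 * M - m + 2 * n * M : ℕ) : ℝ) ^ 2 + γ ^ 2)) := by
    refine continuous_tsum (fun n => ?_)
      ((hsum.comp_injective (hinj m)).add (hsum.comp_injective (hinj (2 * M - m)))) fun n γ => ?_
    · have h₁ : (0 : ℝ) < (m + 2 * n * M : ℕ) := by exact_mod_cast (by lia)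
      have h₂ : (0 : ℝ) < (2 * M - m + 2 * n * M : ℕ) := by exact_mod_cast (by lia)
      exact (continuous_const.div (by fun_prop) fun γ => by positivity).add
        (continuous_const.div (by fun_prop) fun γ => by positivity)
    · rw [Real.norm_of_nonneg (by positivity)]
      exact add_le_add (hle _ (by lia) γ) (hle _ (by lia) γ)
  have hlim := (hcont.tendsto 0).mono_left (nhdsWithin_le_nhds (s := Set.Ioi 0))
  have hslope : Filter.Tendsto (fun γ : ℝ => Real.sinh (γ / M) / γ) (nhdsWithin 0 (Set.Ioi 0))
      (nhds (1 / M)) := by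
    have hd : HasDerivAt (fun γ : ℝ => Real.sinh (γ / M)) (1 / M) 0 := by
      simpa using ((hasDerivAt_id (0 : ℝ)).div_const (M : ℝ)).sinh
    have := hd.tendsto_slope_zero_right
    simpa [div_eq_inv_mul] using this
  have hcosh : Filter.Tendsto (fun γ : ℝ => 2 * M * (Real.cosh (γ / M) - Real.cos (π * m / M)))
      (nhdsWithin 0 (Set.Ioi 0)) (nhds (2 * M * (1 - Real.cos (π * m / M)))) := by
    have hc : Continuous fun γ : ℝ => 2 * M * (Real.cosh (γ / M) - Real.cos (π * m / M)) := by
      fun_prop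
    simpa using (hc.tendsto 0).mono_left nhdsWithin_le_nhds
  have hlim' := hslope.div hcosh (by
    have : 1 - Real.cos (π * m / M) ≠ 0 := by linarith
    simp [hM, this])
  have huniq := tendsto_nhds_unique hlim (hlim'.congr' ?_)
  · simpa using huniq
  · filter_upwards [self_mem_nhdsWithin] with γ hγ
    rw [tsum_reflected_of_pos hm₁ hm₂ hγ, Pi.div_apply, div_div]
    ring

theorem tsum_indicator_reflected {M m : ℕ} (hm₁ : 1 ≤ m) (hm₂ : m < M) {q : ℕ → ℝ}
    (hq : Summable q) :
    ∑' n : ℕ, ({n : ℕ | (∃ ℓ : ℕ, n = m + 2 * ℓ * M) ∨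
        (∃ ℓ : ℕ, n = 2 * M - m + 2 * ℓ * M)} : Set ℕ).indicator q n =
      ∑' n : ℕ, (q (m + 2 * n * M) + q (2 * M - m + 2 * n * M)) := by
  have hinj : ∀ a : ℕ, Function.Injective fun n : ℕ => a + 2 * n * M := fun a n n' h => by
    have := Nat.eq_of_mul_eq_mul_right (by lia : 0 < M) (Nat.add_left_cancel h)
    lia
  have hset : {n : ℕ | (∃ ℓ : ℕ, n = m + 2 * ℓ * M) ∨ (∃ ℓ : ℕ, n = 2 * M - m + 2 * ℓ * M)} =
      Set.range (fun n : ℕ => m + 2 * n * M) ∪ Set.range (fun n : ℕ => 2 * M - m + 2 * n * M) := by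
    ext n
    simp only [Set.mem_ofPred_eq, Set.mem_union, Set.mem_range, eq_comm]
  have hdisj : Disjoint (Set.range fun n : ℕ => m + 2 * n * M)
      (Set.range fun n : ℕ => 2 * M - m + 2 * n * M) := by
    rw [Set.disjoint_left]
    rintro _ ⟨a, rfl⟩ ⟨b, hb⟩
    have hmod := congrArg (· % (2 * M)) hb
    simp only [show ∀ c n : ℕ, c + 2 * n * M = c + 2 * M * n by intros; ring,
      Nat.add_mul_mod_self_left] at hmod
    rw [Nat.mod_eq_of_lt (by lia), Nat.mod_eq_of_lt (by lia)] at hmod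
    lia
  rw [← _root_.tsum_subtype, hset, (hq.subtype _).tsum_union_disjoint hdisj (hq.subtype _),
    tsum_range q (hinj m), tsum_range q (hinj (2 * M - m))]
  exact ((hq.comp_injective (hinj m)).tsum_add (hq.comp_injective (hinj (2 * M - m)))).symm

theorem quadratic_form_sin_grid {M m : ℕ} (hm₁ : 1 ≤ m) (hm₂ : m < M) {g h : ℕ → ℝ} {A c : ℝ}
    {G : ℕ → ℕ → ℝ} (hsymm : ∀ k l, G k l = G l k)
    (hG : ∀ k l, k ≤ l → l ≤ M → G k l = A * (g k * h l))
    (hg : ∀ k, g (k + 2) + g k = 2 * c * g (k + 1))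
    (hh : ∀ k, h (k + 2) + h k = 2 * c * h (k + 1))
    (hg0 : g 0 = 0) (hhM : h M = 0) (hc : c ≠ Real.cos (π * m / M)) :
    ∑ k ∈ range (M + 1), ∑ l ∈ range (M + 1),
        G k l * Real.sin (π * m / M * k) * Real.sin (π * m / M * l) =
      A * (h 0 * g 1) * M / (4 * (c - Real.cos (π * m / M))) := by
  set θ : ℝ := π * m / M with hθ
  have hM : (M : ℝ) ≠ 0 := by exact_mod_cast (by lia : M ≠ 0)
  have hv : ∀ k : ℕ, Real.sin (θ * (k + 2 : ℕ)) + Real.sin (θ * k) =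
      2 * Real.cos θ * Real.sin (θ * (k + 1 : ℕ)) := fun k => by
    rw [show θ * (k + 2 : ℕ) = θ * (k + 1 : ℕ) + θ by push_cast; ring,
      show θ * (k : ℕ) = θ * (k + 1 : ℕ) - θ by push_cast; ring, Real.sin_add, Real.sin_sub]
    ring
  have hvM : Real.sin (θ * M) = 0 := by
    rw [hθ, div_mul_cancel₀ _ hM, mul_comm, Real.sin_nat_mul_pi]
  have hcol : ∀ k ∈ range (M + 1), (2 * c - 2 * Real.cos θ) * ∑ l ∈ range (M + 1),
      G k l * Real.sin (θ * k) * Real.sin (θ * l) =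
      A * (h 0 * g 1) * Real.sin (θ * k) ^ 2 := by
    intro k hk
    have hk : k ≤ M := Nat.lt_succ_iff.1 (mem_range.1 hk)
    have key := three_term_eigen_sum (v := fun l : ℕ => Real.sin (θ * l)) hg hh hv hg0
      (by simp) hhM hvM hk
    have : ∑ l ∈ range (M + 1), G k l * Real.sin (θ * k) * Real.sin (θ * l) =
        A * Real.sin (θ * k) *
          ∑ l ∈ range (M + 1), g (min l k) * h (max l k) * Real.sin (θ * l) := by
      rw [mul_sum]
      refine sum_congr rfl fun l hl => ?_
      have hl : l ≤ M := Nat.lt_succ_iff.1 (mem_range.1 hl)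
      rcases le_total l k with hlk | hlk
      · rw [min_eq_left hlk, max_eq_right hlk, hsymm, hG l k hlk hk]; ring
      · rw [min_eq_right hlk, max_eq_left hlk, hG k l hlk hl]; ring
    rw [this]
    linear_combination A * Real.sin (θ * k) * key
  have htot := sum_congr rfl hcol
  rw [← mul_sum, ← mul_sum, sum_sin_sq_grid hm₁ hm₂] at htot
  have hcd : c - Real.cos θ ≠ 0 := sub_ne_zero.2 hc
  rw [eq_div_iff (by simpa using hcd)]
  linear_combination 2 * htot

/-- Lemma 1 (full-sum form). Under the standing parameter assumptions, with
`Γ = ϑ₁²/(4ϑ₂²) − ϑ₀/ϑ₂`, `Γ₀ = √|Γ|`, `λ_ℓ = π² ϑ₂ ℓ² + ϑ₁²/(4ϑ₂) − ϑ₀` and the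
symmetric kernel `ρ` given piecewise by the stated trigonometric / hyperbolic
formulas, for every `M ≥ 2` and `1 ≤ m ≤ M − 1`, with grid points `y_k = k/M` and
`I_m = I_m^+ ∪ I_m^−`:
`∑_{ℓ ∈ I_m} σ²/(2λ_ℓ) = (2/M²) ∑_{k,l=0}^{M} ρ(y_k, y_l) sin(π m y_k) sin(π m y_l)`
(with the series converging absolutely), and consequently for any `L ≥ 1`,
`s_m² = ∑_{ℓ ∈ I_m, ℓ ≥ LM} σ²/(2λ_ℓ)
      = (1/M²) b_m^⊤ Σ b_m − ∑_{ℓ ∈ I_m, ℓ < LM} σ²/(2λ_ℓ)`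
with `Σ_{kl} = ρ(y_k, y_l)` and `b_m(k) = √2 sin(π m y_k)`. -/
theorem replacement_variance_formula
    (σsq ϑ₀ ϑ₁ ϑ₂ : ℝ) (hσ : 0 < σsq) (hϑ₂ : 0 < ϑ₂)
    (hparam : ϑ₁ ^ 2 / (4 * ϑ₂ ^ 2) - ϑ₀ / ϑ₂ + π ^ 2 > 0)
    (Γ Γ₀ : ℝ) (hΓ : Γ = ϑ₁ ^ 2 / (4 * ϑ₂ ^ 2) - ϑ₀ / ϑ₂) (hΓ₀ : Γ₀ = Real.sqrt |Γ|)
    (lam : ℕ → ℝ)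
    (hlam : ∀ ℓ : ℕ, lam ℓ = π ^ 2 * ϑ₂ * ℓ ^ 2 + ϑ₁ ^ 2 / (4 * ϑ₂) - ϑ₀)
    (ρ : ℝ → ℝ → ℝ)
    (hρsym : ∀ x y : ℝ, ρ x y = ρ y x)
    (hρ : ∀ x y : ℝ, 0 ≤ x → x ≤ y → y ≤ 1 →
      ρ x y = if Γ < 0 then
          σsq / (2 * ϑ₂) * (Real.sin (Γ₀ * (1 - y)) * Real.sin (Γ₀ * x)
            / (Γ₀ * Real.sin Γ₀))
        else if Γ = 0 then
          σsq / (2 * ϑ₂) * (x * (1 - y))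
        else
          σsq / (2 * ϑ₂) * (Real.sinh (Γ₀ * (1 - y)) * Real.sinh (Γ₀ * x)
            / (Γ₀ * Real.sinh Γ₀)))
    (M m : ℕ) (hM : 2 ≤ M) (hm₁ : 1 ≤ m) (hm₂ : m ≤ M - 1)
    (y : ℕ → ℝ) (hy : ∀ k : ℕ, y k = (k : ℝ) / M)
    (S : Set ℕ)
    (hS : S = {n : ℕ | (∃ ℓ : ℕ, n = m + 2 * ℓ * M) ∨
                       (∃ ℓ : ℕ, n = 2 * M - m + 2 * ℓ * M)})
    (f : ℕ → ℝ) (hf : ∀ n : ℕ, f n = σsq / (2 * lam n)) :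
    Summable (S.indicator f) ∧
    (∑' n : ℕ, S.indicator f n)
      = (2 / (M : ℝ) ^ 2) * ∑ k ∈ Finset.range (M + 1), ∑ l ∈ Finset.range (M + 1),
          ρ (y k) (y l) * Real.sin (π * m * y k) * Real.sin (π * m * y l) ∧
    ∀ L : ℕ, 1 ≤ L →
      (∑' n : ℕ, ({n : ℕ | n ∈ S ∧ L * M ≤ n} : Set ℕ).indicator f n)
        = (1 / (M : ℝ) ^ 2) *
            (∑ k ∈ Finset.range (M + 1), ∑ l ∈ Finset.range (M + 1),
              (Real.sqrt 2 * Real.sin (π * m * y k)) * ρ (y k) (y l) *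
                (Real.sqrt 2 * Real.sin (π * m * y l)))
          - ∑ n ∈ Finset.range (L * M), S.indicator f n := by
  have hmM : m < M := by lia
  have hMpos : (0 : ℝ) < M := by exact_mod_cast (by lia : 0 < M)
  have hMne := hMpos.ne'
  have hΓπ : 0 < Γ + π ^ 2 := by rw [hΓ]; exact hparam
  have hf' : f = fun n : ℕ => σsq / (2 * ϑ₂) * (1 / (π ^ 2 * (n : ℝ) ^ 2 + Γ)) := by
    funext n
    rw [hf, hlam, show π ^ 2 * ϑ₂ * (n : ℝ) ^ 2 + ϑ₁ ^ 2 / (4 * ϑ₂) - ϑ₀ =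
      ϑ₂ * (π ^ 2 * (n : ℝ) ^ 2 + Γ) by rw [hΓ]; field_simp; ring, div_mul_div_comm, mul_one,
      mul_assoc]
  have hfs : Summable f := by
    rw [hf']
    exact (summable_one_div_pi_sq_mul_sq_add hΓπ).mul_left _
  have hgrid : ∀ k : ℕ, π * m * y k = π * m / M * k := fun k => by rw [hy]; ring
  have hρ' : ∀ k l : ℕ, k ≤ l → l ≤ M → 0 ≤ y k ∧ y k ≤ y l ∧ y l ≤ 1 := fun k l hkl hlM => by
    simp only [hy]
    refine ⟨by positivity, ?_, ?_⟩
    · gcongr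
    · rw [div_le_one hMpos]; exact_mod_cast hlM
  have htotal : ∑' n : ℕ, S.indicator f n =
      (2 / (M : ℝ) ^ 2) * ∑ k ∈ Finset.range (M + 1), ∑ l ∈ Finset.range (M + 1),
        ρ (y k) (y l) * Real.sin (π * m * y k) * Real.sin (π * m * y l) := by
    rw [hS, tsum_indicator_reflected hm₁ hmM hfs, hf']
    simp_rw [hgrid, ← mul_add]
    rw [tsum_mul_left]
    have hy0 : y 0 = 0 := by simp [hy]
    have hyM : y M = 1 := by rw [hy, div_self hMne]
    have hy1 : ∀ k, y k = y (k + 1) - 1 / M := fun k => by simp only [hy]; push_cast; ring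
    have hy2 : ∀ k, y (k + 2) = y (k + 1) + 1 / M := fun k => by simp only [hy]; push_cast; ring
    have hy1' : y 1 = 1 / M := by simp [hy]
    rcases lt_trichotomy Γ 0 with hneg | hzero | hpos
    · have hsq : Γ = -Γ₀ ^ 2 := by rw [hΓ₀, Real.sq_sqrt (abs_nonneg _), abs_of_neg hneg, neg_neg]
      have hpos : 0 < Γ₀ := by rw [hΓ₀]; exact Real.sqrt_pos.2 (abs_pos.2 hneg.ne)
      have hlt : Γ₀ < π := by
        have := pi_pos
        nlinarith
      have hsin : Real.sin Γ₀ ≠ 0 := (Real.sin_pos_of_pos_of_lt_pi hpos hlt).ne'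
      have hcos : Real.cos (π * m / M) < Real.cos (Γ₀ / M) := by
        have hm1 : (1 : ℝ) ≤ m := by exact_mod_cast hm₁
        have hmM' : (m : ℝ) ≤ M := by exact_mod_cast hmM.le
        refine Real.cos_lt_cos_of_nonneg_of_le_pi (by positivity) ?_ ?_
        · rw [div_le_iff₀ hMpos]
          exact mul_le_mul_of_nonneg_left hmM' pi_pos.le
        · gcongr
          nlinarith [pi_pos]
      rw [quadratic_form_sin_grid hm₁ hmM (G := fun k l => ρ (y k) (y l))
        (g := fun k => Real.sin (Γ₀ * y k)) (h := fun k => Real.sin (Γ₀ * (1 - y k)))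
        (A := σsq / (2 * ϑ₂) / (Γ₀ * Real.sin Γ₀)) (c := Real.cos (Γ₀ / M))
        (fun k l => hρsym _ _) ?_ ?_ ?_ (by simp [hy0]) (by simp [hyM]) hcos.ne', hsq,
        tsum_reflected_of_neg hm₁ hmM hpos hlt, hy0, hy1']
      · have := (sub_pos.2 hcos).ne'
        rw [sub_zero, mul_one, mul_one_div]
        field_simp
        ring
      · intro k l hkl hlM
        obtain ⟨h₁, h₂, h₃⟩ := hρ' k l hkl hlM
        rw [hρ _ _ h₁ h₂ h₃, if_pos hneg]
        ring
      · intro k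
        rw [hy1 k, hy2 k, mul_add, mul_sub, Real.sin_add, Real.sin_sub, mul_one_div]
        ring
      · intro k
        rw [hy1 k, hy2 k, show Γ₀ * (1 - (y (k + 1) + 1 / M)) =
          Γ₀ * (1 - y (k + 1)) - Γ₀ / M by ring, show Γ₀ * (1 - (y (k + 1) - 1 / M)) =
          Γ₀ * (1 - y (k + 1)) + Γ₀ / M by ring, Real.sin_add, Real.sin_sub]
        ring
    · have hcos := cos_pi_mul_div_lt_one hm₁ hmM
      rw [quadratic_form_sin_grid hm₁ hmM (G := fun k l => ρ (y k) (y l))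
        (g := fun k => y k) (h := fun k => 1 - y k)
        (A := σsq / (2 * ϑ₂)) (c := 1)
        (fun k l => hρsym _ _) ?_ ?_ ?_ hy0 (by simp [hyM]) hcos.ne', hzero,
        tsum_reflected_of_zero hm₁ hmM, hy0, hy1']
      · have := (sub_pos.2 hcos).ne'
        field_simp
        ring
      · intro k l hkl hlM
        obtain ⟨h₁, h₂, h₃⟩ := hρ' k l hkl hlM
        rw [hρ _ _ h₁ h₂ h₃, if_neg hzero.not_lt, if_pos hzero]
      · intro k
        rw [hy1 k, hy2 k]
        ring
      · intro k
        rw [hy1 k, hy2 k]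
        ring
    · have hsq : Γ = Γ₀ ^ 2 := by rw [hΓ₀, Real.sq_sqrt (abs_nonneg _), abs_of_pos hpos]
      have hpos' : 0 < Γ₀ := by rw [hΓ₀]; exact Real.sqrt_pos.2 (abs_pos.2 hpos.ne')
      have hsinh : Real.sinh Γ₀ ≠ 0 := (Real.sinh_pos_iff.2 hpos').ne'
      have hcos := (cos_pi_mul_div_lt_one hm₁ hmM).trans_le (Real.one_le_cosh (Γ₀ / M))
      rw [quadratic_form_sin_grid hm₁ hmM (G := fun k l => ρ (y k) (y l))
        (g := fun k => Real.sinh (Γ₀ * y k)) (h := fun k => Real.sinh (Γ₀ * (1 - y k)))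
        (A := σsq / (2 * ϑ₂) / (Γ₀ * Real.sinh Γ₀)) (c := Real.cosh (Γ₀ / M))
        (fun k l => hρsym _ _) ?_ ?_ ?_ (by simp [hy0]) (by simp [hyM]) hcos.ne', hsq,
        tsum_reflected_of_pos hm₁ hmM hpos', hy0, hy1']
      · have := (sub_pos.2 hcos).ne'
        rw [sub_zero, mul_one, mul_one_div]
        field_simp
        ring
      · intro k l hkl hlM
        obtain ⟨h₁, h₂, h₃⟩ := hρ' k l hkl hlM
        rw [hρ _ _ h₁ h₂ h₃, if_neg hpos.not_gt, if_neg hpos.ne']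
        ring
      · intro k
        rw [hy1 k, hy2 k, mul_add, mul_sub, Real.sinh_add, Real.sinh_sub, mul_one_div]
        ring
      · intro k
        rw [hy1 k, hy2 k, show Γ₀ * (1 - (y (k + 1) + 1 / M)) =
          Γ₀ * (1 - y (k + 1)) - Γ₀ / M by ring, show Γ₀ * (1 - (y (k + 1) - 1 / M)) =
          Γ₀ * (1 - y (k + 1)) + Γ₀ / M by ring, Real.sinh_add, Real.sinh_sub]
        ring
  refine ⟨hfs.indicator S, htotal, fun L _ => ?_⟩
  have hquad : (1 / (M : ℝ) ^ 2) *
      (∑ k ∈ Finset.range (M + 1), ∑ l ∈ Finset.range (M + 1),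
        (Real.sqrt 2 * Real.sin (π * m * y k)) * ρ (y k) (y l) *
          (Real.sqrt 2 * Real.sin (π * m * y l))) = ∑' n : ℕ, S.indicator f n := by
    rw [htotal, mul_sum, mul_sum]
    refine sum_congr rfl fun k _ => ?_
    rw [mul_sum, mul_sum]
    refine sum_congr rfl fun l _ => ?_
    linear_combination (1 / (M : ℝ) ^ 2) * Real.sin (π * m * y k) * ρ (y k) (y l) *
      Real.sin (π * m * y l) * Real.mul_self_sqrt (zero_le_two (α := ℝ))
  have htail : ({n : ℕ | n ∈ S ∧ L * M ≤ n} : Set ℕ).indicator f =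
      ((range (L * M) : Set ℕ)ᶜ).indicator (S.indicator f) := by
    rw [Set.indicator_indicator]
    congr 1
    ext n
    simp [and_comm]
  rw [hquad, htail, ← _root_.tsum_subtype, eq_sub_iff_add_eq', (hfs.indicator S).sum_add_tsum_compl]
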